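/- arXiv:math/0512413 — 10 statements merged into one kernel-verified Lean document; each statement's English description precedes it below -/
import Mathlib

section
/- Let L be a bounded lattice equipped with an antitone involution x ↦ xᶜ satisfying x ⊔ xᶜ = ⊤ and x ⊓ xᶜ = ⊥ for all x, and assume the weak modularity condition: for all a, m, c with a ≤ mᶜ and mᶜ ≤ c one has (a ⊔ m) ⊓ c = a ⊔ (m ⊓ c). Then every segment [a, c] (with a ≤ c) is again a logic with least element a, greatest element c and complementation b ↦ a ⊔ (bᶜ ⊓ c); precisely, for every b with a ≤ b ≤ c, the element f(b) := a ⊔ (bᶜ ⊓ c) satisfies: a ≤ f(b) ≤ c, f(b) = (a ⊔ bᶜ) ⊓ c, b ⊔ f(b) = c, b ⊓ f(b) = a, f(f(b)) = b, and f is antitone on the segment: a ≤ b₁ ≤ b₂ ≤ c implies f(b₂) ≤ f(b₁). -/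
theorem map_sup_of_antitone_involutive {L : Type*} [Lattice L] {f : L → L}
    (hf : Antitone f) (hinv : Function.Involutive f) (x y : L) :
    f (x ⊔ y) = f x ⊓ f y := by
  apply le_antisymm (le_inf (hf le_sup_left) (hf le_sup_right))
  rw [← hinv (f x ⊓ f y)]
  apply hf
  apply sup_le
  · simpa only [hinv x] using hf (inf_le_left : f x ⊓ f y ≤ f x)
  · simpa only [hinv y] using hf (inf_le_right : f x ⊓ f y ≤ f y)

theorem map_inf_of_antitone_involutive {L : Type*} [Lattice L] {f : L → L}
    (hf : Antitone f) (hinv : Function.Involutive f) (x y : L) :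
    f (x ⊓ y) = f x ⊔ f y := by
  rw [← hinv (f x ⊔ f y), map_sup_of_antitone_involutive hf hinv, hinv x, hinv y]


/-- In a bounded lattice with an antitone involutive complementation
satisfying `x ⊔ xᶜ = ⊤`, `x ⊓ xᶜ = ⊥` and the weak modularity condition, every segment
`[a, c]` is again a logic, with least element `a`, greatest element `c` and
complementation `b ↦ a ⊔ (bᶜ ⊓ c)`. -/
theorem segment_is_logic {L : Type*} [Lattice L] [BoundedOrder L] (compl : L → L)
    (h_anti : ∀ x y : L, x ≤ y → compl y ≤ compl x)
    (h_inv : ∀ x : L, compl (compl x) = x)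
    (h_sup : ∀ x : L, x ⊔ compl x = ⊤)
    (h_inf : ∀ x : L, x ⊓ compl x = ⊥)
    (h_wm : ∀ a m c : L, a ≤ compl m → compl m ≤ c → (a ⊔ m) ⊓ c = a ⊔ (m ⊓ c))
    (a c : L) (hac : a ≤ c) :
    (∀ b : L, a ≤ b → b ≤ c →
      a ≤ a ⊔ (compl b ⊓ c) ∧
      a ⊔ (compl b ⊓ c) ≤ c ∧
      a ⊔ (compl b ⊓ c) = (a ⊔ compl b) ⊓ c ∧
      b ⊔ (a ⊔ (compl b ⊓ c)) = c ∧
      b ⊓ (a ⊔ (compl b ⊓ c)) = a ∧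
      a ⊔ (compl (a ⊔ (compl b ⊓ c)) ⊓ c) = b) ∧
    (∀ b₁ b₂ : L, a ≤ b₁ → b₁ ≤ b₂ → b₂ ≤ c →
      a ⊔ (compl b₂ ⊓ c) ≤ a ⊔ (compl b₁ ⊓ c)) := by
  have hf : Antitone compl := fun x y h => h_anti x y h
  have sup_compl_inf : ∀ {x y : L}, x ≤ y → x ⊔ (compl x ⊓ y) = y := by
    intro x y h
    rw [← h_wm x (compl x) y (h_inv x).ge ((h_inv x).trans_le h), h_sup, top_inf_eq]
  have sup_compl_inf_self : ∀ {x y : L}, x ≤ y → (x ⊔ compl y) ⊓ y = x := by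
    intro x y h
    rw [h_wm x (compl y) y (h.trans (h_inv y).ge) (h_inv y).le, inf_comm (compl y), h_inf,
      sup_bot_eq]
  refine ⟨fun b hab hbc => ?_, fun b₁ b₂ _ h _ =>
    sup_le_sup_left (inf_le_inf_right c (h_anti _ _ h)) a⟩
  have hmod : (a ⊔ compl b) ⊓ c = a ⊔ (compl b ⊓ c) :=
    h_wm a (compl b) c (hab.trans (h_inv b).ge) ((h_inv b).trans_le hbc)
  refine ⟨le_sup_left, sup_le hac inf_le_right, hmod.symm, ?_, ?_, ?_⟩
  · rw [← sup_assoc, sup_eq_left.mpr hab, sup_compl_inf hbc]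
  · rw [← hmod, inf_comm, inf_assoc, inf_eq_right.mpr hbc, sup_compl_inf_self hab]
  · rw [map_sup_of_antitone_involutive hf h_inv, map_inf_of_antitone_involutive hf h_inv,
      h_inv, inf_assoc, sup_compl_inf_self hbc, sup_compl_inf hab]
end

section
/- Let A be a σ-complete Boolean algebra, i.e. a Boolean algebra in which every countable family f : ℕ → A has a least upper bound. Then there exist a set X, a σ-algebra Σ of subsets of X, and a surjective map φ from Σ onto A such that φ(∅) = ⊥, φ(X) = ⊤, φ(X \ S) = (φ S)ᶜ for all S ∈ Σ, and for every sequence (Sₙ) in Σ the element φ(⋃ₙ Sₙ) is the least upper bound in A of the family (φ(Sₙ))ₙ. In particular A is σ-isomorphic to the quotient of the σ-field Σ by the σ-ideal {S ∈ Σ : φ(S) = ⊥}. -/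
namespace LoomisSikorski

open Filter Set

/-- The Stone space of a Boolean algebra, as the type of its prime ideals. -/
abbrev StoneSpace (A : Type*) [BooleanAlgebra A] : Type _ :=
  {I : Order.Ideal A // I.IsPrime}

variable {A : Type*} [BooleanAlgebra A] {a b s : A} {f : ℕ → A}

/-- The basic clopen subset of the Stone space attached to an element of the algebra. -/
def basicClopen (a : A) : Set (StoneSpace A) :=
  {x | a ∉ x.1}

theorem basicClopen_mono (h : a ≤ b) : basicClopen a ⊆ basicClopen b :=
  fun x ha hb => ha (x.1.lower h hb)

theorem basicClopen_bot : basicClopen (⊥ : A) = ∅ :=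
  eq_empty_of_forall_notMem fun x hx => hx x.1.bot_mem

theorem disjoint_basicClopen (h : Disjoint a b) : Disjoint (basicClopen a) (basicClopen b) :=
  Set.disjoint_left.2 fun x ha hb =>
    (x.2.mem_or_mem (h.eq_bot ▸ x.1.bot_mem : a ⊓ b ∈ x.1)).elim ha hb

theorem basicClopen_compl (a : A) : basicClopen aᶜ = (basicClopen a)ᶜ := by
  refine (disjoint_basicClopen disjoint_compl_left).subset_compl_right.antisymm fun x hx ha => ?_
  refine x.2.toIsProper.ne_univ (eq_univ_of_forall fun c => x.1.lower le_top ?_)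
  rw [← sup_compl_eq_top (x := a)]
  exact Order.Ideal.sup_mem (not_not.1 hx) ha

/-- The subset of the Stone space where a prescribed supremum `s` of `f` is attained. -/
def supSet (f : ℕ → A) (s : A) : Set (StoneSpace A) :=
  {x | x ∈ basicClopen s → ∃ n, x ∈ basicClopen (f n)}

theorem exists_basicClopen_subset_supSet (hs : IsLUB (range f) s) (hb : b ≠ ⊥) :
    ∃ c ≤ b, c ≠ ⊥ ∧ basicClopen c ⊆ supSet f s := by
  by_cases h : ∃ n, b ⊓ f n ≠ ⊥
  · obtain ⟨n, hn⟩ := h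
    exact ⟨b ⊓ f n, inf_le_left, hn, fun x hx _ => ⟨n, basicClopen_mono inf_le_right hx⟩⟩
  · push Not at h
    have hsb : s ≤ bᶜ := hs.2 <| by
      rintro _ ⟨n, rfl⟩
      exact (disjoint_iff.2 (h n)).le_compl_left
    exact ⟨b, le_rfl, hb, fun x hx hxs =>
      ((disjoint_basicClopen (disjoint_compl_right.mono_right hsb)).le_bot ⟨hx, hxs⟩).elim⟩

/-- **Rasiowa–Sikorski lemma**: a nonzero element of a Boolean algebra belongs to an ultrafilter
meeting countably many prescribed dense sets. -/
theorem exists_mem_basicClopen_of_dense {D : ℕ → Set A}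
    (hD : ∀ k, ∀ b : A, b ≠ ⊥ → ∃ c ≤ b, c ≠ ⊥ ∧ c ∈ D k) (ha : a ≠ ⊥) :
    ∃ x ∈ basicClopen a, ∀ k, ∃ c ∈ D k, x ∈ basicClopen c := by
  choose! next hle hne hmem using hD
  let u : ℕ → A := fun k => Nat.rec a next k
  have hu : ∀ k, u k ≠ ⊥ := fun k => Nat.rec ha (fun k ih => hne k _ ih) k
  have hanti : Antitone u := antitone_nat_of_succ_le fun k => hle k _ (hu k)
  have hF : Order.IsPFilter {z | ∃ k, u k ≤ z} := by
    refine .of_def ⟨u 0, 0, le_rfl⟩ ?_ fun hxy ⟨k, hk⟩ => ⟨k, hk.trans hxy⟩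
    rintro y ⟨k, hk⟩ z ⟨m, hm⟩
    exact ⟨u (max k m), ⟨_, le_rfl⟩, (hanti (le_max_left k m)).trans hk,
      (hanti (le_max_right k m)).trans hm⟩
  have hdisj : Disjoint (hF.toPFilter : Set A) (⊥ : Order.Ideal A) := by
    refine Set.disjoint_left.2 ?_
    rintro z ⟨k, hk⟩ hz
    exact hu k (le_bot_iff.1 (hk.trans hz))
  obtain ⟨J, hJ, -, hFJ⟩ := DistribLattice.prime_ideal_of_disjoint_filter_ideal hdisj
  have huJ (k : ℕ) : u k ∉ J := Set.disjoint_left.1 hFJ ⟨k, le_rfl⟩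
  exact ⟨⟨J, hJ⟩, huJ 0, fun k => ⟨u (k + 1), hmem k _ (hu k), huJ (k + 1)⟩⟩

variable (A) in
/-- The filter on the Stone space of sets containing a countable intersection of sets `supSet f s`;
it plays the role of the filter of comeagre sets. -/
def genericFilter : Filter (StoneSpace A) :=
  countableGenerate {E | ∃ (f : ℕ → A) (s : A), IsLUB (range f) s ∧ E = supSet f s}

instance : CountableInterFilter (genericFilter A) :=
  inferInstanceAs (CountableInterFilter (countableGenerate _))

theorem supSet_mem_genericFilter (hs : IsLUB (range f) s) : supSet f s ∈ genericFilter A :=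
  mem_countableGenerate_iff.2
    ⟨{supSet f s}, by simpa using ⟨f, s, hs, rfl⟩, countable_singleton _, by simp⟩

theorem eq_bot_of_compl_basicClopen_mem (h : (basicClopen a)ᶜ ∈ genericFilter A) : a = ⊥ := by
  by_contra ha
  obtain ⟨S, hSg, hSc, hS⟩ := mem_countableGenerate_iff.1 h
  obtain ⟨E, hE⟩ := countable_iff_exists_subset_range.1 hSc
  obtain ⟨x, hxa, hx⟩ := exists_mem_basicClopen_of_dense
    (D := fun k => {c | E k ∈ S → basicClopen c ⊆ E k}) (fun k b hb => by
      by_cases hk : E k ∈ S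
      · obtain ⟨f, s, hs, hEk⟩ := hSg hk
        obtain ⟨c, hcb, hc, hcE⟩ := exists_basicClopen_subset_supSet hs hb
        exact ⟨c, hcb, hc, fun _ => hEk ▸ hcE⟩
      · exact ⟨b, le_rfl, hb, fun h => (hk h).elim⟩) ha
  refine hS (mem_sInter.2 fun T hT => ?_) hxa
  obtain ⟨k, rfl⟩ := hE hT
  obtain ⟨c, hc, hxc⟩ := hx k
  exact hc hT hxc

theorem le_of_basicClopen_eventuallyLE (h : basicClopen a ≤ᶠ[genericFilter A] basicClopen b) :
    a ≤ b := by
  rw [← disjoint_compl_right_iff, disjoint_iff]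
  refine eq_bot_of_compl_basicClopen_mem ?_
  filter_upwards [h] with x hx hab
  have hb := basicClopen_mono inf_le_right hab
  rw [basicClopen_compl] at hb
  exact hb (hx (basicClopen_mono inf_le_left hab))

theorem eq_of_basicClopen_eventuallyEq (h : basicClopen a =ᶠ[genericFilter A] basicClopen b) :
    a = b :=
  (le_of_basicClopen_eventuallyLE h.le).antisymm (le_of_basicClopen_eventuallyLE h.symm.le)

theorem iUnion_basicClopen_eventuallyEq (hs : IsLUB (range f) s) :
    ⋃ n, basicClopen (f n) =ᶠ[genericFilter A] basicClopen s := by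
  refine EventuallyLE.antisymm ?_ ?_
  · exact (iUnion_subset fun n => basicClopen_mono (hs.1 ⟨n, rfl⟩)).eventuallyLE
  · filter_upwards [supSet_mem_genericFilter hs] with x hx hxs
    exact mem_iUnion.2 (hx hxs)

/-- The σ-algebra of sets generically equal to a basic clopen set. -/
abbrev genericMeasurableSpace (hσ : ∀ f : ℕ → A, ∃ s : A, IsLUB (range f) s) :
    MeasurableSpace (StoneSpace A) where
  MeasurableSet' S := ∃ a, S =ᶠ[genericFilter A] basicClopen a
  measurableSet_empty := ⟨⊥, basicClopen_bot (A := A) ▸ .rfl⟩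
  measurableSet_compl := fun S ⟨a, ha⟩ => ⟨aᶜ, basicClopen_compl a ▸ ha.compl⟩
  measurableSet_iUnion S hS := by
    choose a ha using hS
    obtain ⟨s, hs⟩ := hσ a
    exact ⟨s, (Filter.EventuallyEq.countable_iUnion ha).trans (iUnion_basicClopen_eventuallyEq hs)⟩

open Classical in
/-- The element whose basic clopen set is generically equal to `S`, if there is one. -/
noncomputable def classOf (S : Set (StoneSpace A)) : A :=
  if h : ∃ a, S =ᶠ[genericFilter A] basicClopen a then h.choose else ⊥

theorem eventuallyEq_classOf {S : Set (StoneSpace A)}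
    (h : ∃ a, S =ᶠ[genericFilter A] basicClopen a) :
    S =ᶠ[genericFilter A] basicClopen (classOf S) := by
  rw [classOf, dif_pos h]
  exact h.choose_spec

theorem classOf_eq {S : Set (StoneSpace A)} (h : S =ᶠ[genericFilter A] basicClopen a) :
    classOf S = a :=
  eq_of_basicClopen_eventuallyEq ((eventuallyEq_classOf ⟨a, h⟩).symm.trans h)

end LoomisSikorski

open LoomisSikorski

/-- **Loomis–Sikorski.**  Every σ-complete Boolean algebra `A` is a
σ-homomorphic image of a σ-field of sets: there are a set `X`, a σ-algebra `Σ` on `X`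
and a surjection `φ` from the measurable sets onto `A` preserving `⊥`, `⊤`, complements
and countable suprema. -/
theorem sigma_complete_boolean_algebra_is_quotient_of_sigma_field
    {A : Type u} [BooleanAlgebra A]
    (hσ : ∀ f : ℕ → A, ∃ s : A, IsLUB (Set.range f) s) :
    ∃ (X : Type u) (_ : MeasurableSpace X) (φ : Set X → A),
      (∀ a : A, ∃ S : Set X, MeasurableSet S ∧ φ S = a) ∧
      φ ∅ = ⊥ ∧
      φ Set.univ = ⊤ ∧
      (∀ S : Set X, MeasurableSet S → φ (Set.univ \ S) = (φ S)ᶜ) ∧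
      (∀ S : ℕ → Set X, (∀ n, MeasurableSet (S n)) →
        IsLUB (Set.range fun n => φ (S n)) (φ (⋃ n, S n))) := by
  refine ⟨StoneSpace A, genericMeasurableSpace hσ,
    classOf, fun a => ⟨basicClopen a, ⟨a, .rfl⟩,
      classOf_eq .rfl⟩, ?_, ?_, fun S hS => ?_, fun S hS => ?_⟩
  · exact classOf_eq (basicClopen_bot (A := A) ▸ .rfl)
  · refine classOf_eq ?_
    rw [← compl_bot, basicClopen_compl, basicClopen_bot,
      Set.compl_empty]
    exact .rfl
  · refine classOf_eq ?_
    rw [← Set.compl_eq_univ_sdiff, basicClopen_compl]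
    exact (eventuallyEq_classOf hS).compl
  · obtain ⟨s, hs⟩ := hσ fun n => classOf (S n)
    rwa [classOf_eq ((Filter.EventuallyEq.countable_iUnion fun n =>
      eventuallyEq_classOf (hS n)).trans
        (iUnion_basicClopen_eventuallyEq hs))]
end

section
/- Let E be a complex Hilbert space and let L be a set of closed subspaces of E such that: the zero subspace belongs to L, L contains a greatest element, L is closed under intersection K₁ ⊓ K₂, closed under the closed join K₁ ⊻ K₂ := the closure of K₁ + K₂, and closed under relative orthocomplements (if K', K ∈ L and K' ⊆ K then K ⊓ (K')ᗮ ∈ L). Then the following are equivalent: (i) for all K₁, K₂ ∈ L, K₁ ⊓ K₂ = 0 implies K₁ ⟂ K₂ (i.e. K₂ ⊆ K₁ᗮ); (ii) L is distributive: for all K₁, K₂, K₃ ∈ L, (K₁ ⊻ K₂) ⊓ K₃ = (K₁ ⊓ K₃) ⊻ (K₂ ⊓ K₃). -/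
open Submodule

section

variable {E : Type*} [NormedAddCommGroup E] [InnerProductSpace ℂ E]

/-- If the part of `K` orthogonal to `K ⊓ M` is orthogonal to `M`, then the orthogonal projection
onto `M` maps `K` into `K ⊓ M`. -/
theorem starProjection_mem_inf_of_orthogonal {K M : Submodule ℂ E}
    [M.HasOrthogonalProjection] [(K ⊓ M).HasOrthogonalProjection]
    (h : K ⊓ (K ⊓ M)ᗮ ≤ Mᗮ) {x : E} (hx : x ∈ K) : M.starProjection x ∈ K ⊓ M := by
  have hp : (K ⊓ M).starProjection x ∈ K ⊓ M := starProjection_apply_mem _ x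
  have hq : x - (K ⊓ M).starProjection x ∈ Mᗮ :=
    h ⟨K.sub_mem hx hp.1, sub_starProjection_mem_orthogonal x⟩
  rwa [eq_starProjection_of_mem_orthogonal hp.2 hq]

/-- If the orthogonal projection onto `K₃` maps each `Kᵢ` into `Kᵢ ⊓ K₃`, then the meet with `K₃`
is bounded by the closed join of the meets. -/
theorem topologicalClosure_sup_inf_le {K₁ K₂ K₃ : Submodule ℂ E} [K₃.HasOrthogonalProjection]
    (h₁ : ∀ x ∈ K₁, K₃.starProjection x ∈ K₁ ⊓ K₃)
    (h₂ : ∀ x ∈ K₂, K₃.starProjection x ∈ K₂ ⊓ K₃) :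
    (K₁ ⊔ K₂).topologicalClosure ⊓ K₃ ≤ ((K₁ ⊓ K₃) ⊔ (K₂ ⊓ K₃)).topologicalClosure := by
  rintro x ⟨hx, hx₃⟩
  rw [← starProjection_eq_self_iff.mpr hx₃]
  refine map_mem_closure K₃.starProjection.continuous hx fun y hy => ?_
  obtain ⟨a, ha, b, hb, rfl⟩ := mem_sup.mp hy
  rw [map_add]
  exact add_mem_sup (h₁ a ha) (h₂ b hb)

/-- The meets with a closed subspace `K₃` have closed join below the meet of the closed join. -/
theorem topologicalClosure_inf_sup_inf_le {K₁ K₂ K₃ : Submodule ℂ E}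
    (h₃ : IsClosed (K₃ : Set E)) :
    ((K₁ ⊓ K₃) ⊔ (K₂ ⊓ K₃)).topologicalClosure ≤ (K₁ ⊔ K₂).topologicalClosure ⊓ K₃ :=
  le_inf (topologicalClosure_mono (sup_le_sup inf_le_left inf_le_left))
    (topologicalClosure_minimal _ (sup_le inf_le_right inf_le_right) h₃)

end

/-- **Theorem 2.4.**  For a clan `L` of closed subspaces of a complex Hilbert
space (containing `0`, a greatest element, closed under intersections, closed joins and
relative orthocomplements), distributivity is equivalent to the implication
"non-simultaneous (`K₁ ⊓ K₂ = 0`) implies mutually exclusive (`K₁ ⟂ K₂`)". -/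
theorem clan_distributive_iff_nonsimultaneous_implies_orthogonal
    {E : Type*} [NormedAddCommGroup E] [InnerProductSpace ℂ E] [CompleteSpace E]
    (L : Set (Submodule ℂ E))
    (h_closed : ∀ K ∈ L, IsClosed (K : Set E))
    (h_bot : ⊥ ∈ L)
    (h_top : ∃ T ∈ L, ∀ K ∈ L, K ≤ T)
    (h_inf : ∀ K₁ ∈ L, ∀ K₂ ∈ L, K₁ ⊓ K₂ ∈ L)
    (h_join : ∀ K₁ ∈ L, ∀ K₂ ∈ L, (K₁ ⊔ K₂).topologicalClosure ∈ L)
    (h_relcompl : ∀ K' ∈ L, ∀ K ∈ L, K' ≤ K → K ⊓ K'ᗮ ∈ L) :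
    (∀ K₁ ∈ L, ∀ K₂ ∈ L, K₁ ⊓ K₂ = ⊥ → K₂ ≤ K₁ᗮ) ↔
    (∀ K₁ ∈ L, ∀ K₂ ∈ L, ∀ K₃ ∈ L,
      (K₁ ⊔ K₂).topologicalClosure ⊓ K₃ =
        ((K₁ ⊓ K₃) ⊔ (K₂ ⊓ K₃)).topologicalClosure) := by
  constructor
  · intro h K₁ h₁ K₂ h₂ K₃ h₃
    have := (h_closed K₃ h₃).completeSpace_coe
    have proj : ∀ K ∈ L, ∀ x ∈ K, K₃.starProjection x ∈ K ⊓ K₃ := by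
      intro K hK x hx
      have hKM := h_inf K hK K₃ h₃
      have := (h_closed _ hKM).completeSpace_coe
      refine starProjection_mem_inf_of_orthogonal ?_ hx
      refine h K₃ h₃ _ (h_relcompl _ hKM K hK inf_le_left) ?_
      rw [← inf_assoc, inf_comm K₃ K, inf_orthogonal_eq_bot]
    exact le_antisymm (topologicalClosure_sup_inf_le (proj K₁ h₁) (proj K₂ h₂))
      (topologicalClosure_inf_sup_inf_le (h_closed K₃ h₃))
  · intro h K₁ h₁ K₂ h₂ h₁₂
    obtain ⟨T, hT, hle⟩ := h_top
    have := (h_closed K₁ h₁).completeSpace_coe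
    have hN := h_relcompl K₁ h₁ T hT (hle K₁ h₁)
    have hsup : K₁ ⊔ T ⊓ K₁ᗮ = T := by
      rw [inf_comm]
      exact sup_orthogonal_inf_of_hasOrthogonalProjection (hle K₁ h₁)
    have key := h K₁ h₁ _ hN K₂ h₂
    rw [hsup, h₁₂, bot_sup_eq, (h_closed T hT).submodule_topologicalClosure_eq,
      inf_eq_right.mpr (hle K₂ h₂),
      (h_closed _ (h_inf _ hN K₂ h₂)).submodule_topologicalClosure_eq] at key
    rw [key]
    exact inf_le_left.trans inf_le_right
end

section
/- Let A be an associative ℂ-algebra with an involution a ↦ a*, and let r : A → ℂ be a positive linear functional, i.e. r(a · a*) is a nonnegative real number for every a ∈ A. Let e, e₁ ∈ A be self-adjoint idempotents with e₁·e = e₁ = e·e₁ and r(e) = r(e₁). Then for every a ∈ A with e·a = a = a·e one has r(e₀·a·e₀) = r(e₀·a·e₁) = r(e₁·a·e₀) = 0, where e₀ = e − e₁, and consequently r(a) = r(e₁·a·e₁). -/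
open scoped ComplexOrder

theorem Complex.eq_zero_of_forall_real_mul_add_nonneg {z w : ℂ}
    (h : ∀ t : ℝ, 0 ≤ (t : ℂ) * z + w) : z = 0 := by
  have hre (t : ℝ) : 0 ≤ t * z.re + w.re := by
    simpa using (Complex.le_def.1 (h t)).1
  have him (t : ℝ) : 0 = t * z.im + w.im := by
    simpa using (Complex.le_def.1 (h t)).2
  apply Complex.ext
  · rw [Complex.zero_re]
    by_contra hz
    have := hre (-(w.re + 1) / z.re)
    rw [div_mul_cancel₀ _ hz] at this
    linarith
  · rw [Complex.zero_im]
    linarith [him 0, him 1]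

/-- A null vector of the sesquilinear form `(x, y) ↦ r (x * star y)` of a positive functional `r` is orthogonal
to everything, on both sides. -/
theorem LinearMap.map_mul_star_eq_zero_of_map_mul_star_self_eq_zero {A : Type*}
    [NonUnitalRing A] [Module ℂ A] [SMulCommClass ℂ A A] [IsScalarTower ℂ A A] [StarRing A]
    [StarModule ℂ A] (r : A →ₗ[ℂ] ℂ) (h_pos : ∀ a : A, 0 ≤ r (a * star a))
    {x : A} (hx : r (x * star x) = 0) (y : A) :
    r (x * star y) = 0 ∧ r (y * star x) = 0 := by
  have expand (c : ℂ) : r ((c • x + y) * star (c • x + y)) =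
      c * r (x * star y) + star c * r (y * star x) + r (y * star y) := by
    simp only [star_add, star_smul, add_mul, mul_add, smul_mul_assoc, mul_smul_comm, map_add,
      map_smul, hx, smul_eq_mul]
    ring
  have h_add : r (x * star y) + r (y * star x) = 0 := by
    refine Complex.eq_zero_of_forall_real_mul_add_nonneg (w := r (y * star y)) fun t => ?_
    convert h_pos ((t : ℂ) • x + y) using 1
    rw [expand, Complex.star_def, Complex.conj_ofReal]
    ring
  have h_sub : Complex.I * (r (x * star y) - r (y * star x)) = 0 := by
    refine Complex.eq_zero_of_forall_real_mul_add_nonneg (w := r (y * star y)) fun t => ?_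
    convert h_pos (((t : ℂ) * Complex.I) • x + y) using 1
    rw [expand, Complex.star_def, map_mul (starRingEnd ℂ), Complex.conj_ofReal, Complex.conj_I]
    ring
  have h_eq := (mul_eq_zero.1 h_sub).resolve_left Complex.I_ne_zero
  constructor
  · linear_combination (h_add + h_eq) / 2
  · linear_combination (h_add - h_eq) / 2

/-- Let `r` be a positive linear functional on a complex `*`-algebra,
and let `e, e₁` be self-adjoint idempotents with `e₁ e = e₁ = e e₁` and `r e = r e₁`.
Then for every `a` with `e a = a = a e`, writing `e₀ = e - e₁`, one has
`r (e₀ a e₀) = r (e₀ a e₁) = r (e₁ a e₀) = 0`, and consequently `r a = r (e₁ a e₁)`. -/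
theorem state_localizes_at_support {A : Type*} [NonUnitalRing A] [Module ℂ A]
    [SMulCommClass ℂ A A] [IsScalarTower ℂ A A] [StarRing A] [StarModule ℂ A]
    (r : A →ₗ[ℂ] ℂ)
    (h_pos : ∀ a : A, 0 ≤ r (a * star a))
    (e e₁ : A)
    (h_e_star : star e = e) (h_e_idem : e * e = e)
    (h_e₁_star : star e₁ = e₁) (h_e₁_idem : e₁ * e₁ = e₁)
    (h_maj₁ : e₁ * e = e₁) (h_maj₂ : e * e₁ = e₁)
    (h_val : r e = r e₁) :
    ∀ a : A, e * a = a → a * e = a →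
      r ((e - e₁) * a * (e - e₁)) = 0 ∧
      r ((e - e₁) * a * e₁) = 0 ∧
      r (e₁ * a * (e - e₁)) = 0 ∧
      r a = r (e₁ * a * e₁) := by
  have h_star : star (e - e₁) = e - e₁ := by rw [star_sub, h_e_star, h_e₁_star]
  have h_null : r ((e - e₁) * star (e - e₁)) = 0 := by
    rw [h_star, sub_mul, mul_sub, mul_sub, h_e_idem, h_e₁_idem, h_maj₁, h_maj₂, sub_self,
      sub_zero, map_sub, h_val, sub_self]
  have h_left (b : A) : r ((e - e₁) * b) = 0 := by
    simpa using (r.map_mul_star_eq_zero_of_map_mul_star_self_eq_zero h_pos h_null (star b)).1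
  have h_right (b : A) : r (b * (e - e₁)) = 0 := by
    simpa only [h_star] using
      (r.map_mul_star_eq_zero_of_map_mul_star_self_eq_zero h_pos h_null b).2
  intro a hea hae
  refine ⟨h_right _, by rw [mul_assoc]; exact h_left _, h_right _, ?_⟩
  have h₁ := h_left a
  have h₂ := h_right (e₁ * a)
  rw [sub_mul, hea, map_sub] at h₁
  rw [mul_sub, mul_assoc e₁ a e, hae, map_sub] at h₂
  linear_combination h₁ + h₂
end

section
/- Let N be a quasilogic. For all a, b ∈ N and all c₁, c₂ ∈ N such that a ≤ cᵢ and b ≤ cᵢ − a for i = 1, 2, the element cᵢ − ((cᵢ − a) − b) does not depend on the choice of cᵢ: c₁ − ((c₁ − a) − b) = c₂ − ((c₂ − a) − b); moreover the operation is commutative: c₁ − ((c₁ − a) − b) = c₁ − ((c₁ − b) − a). (This common value is the partial sum a + b.) -/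
/-- A quasilogic structure on a partially ordered set `N`: a subtraction operation
`sub b a` (meaningful when `a ≤ b`, written `b − a`) satisfying
(ax0) `a ≤ b → b − a ≤ b` and `b − (b − a) = a`;
(ax1) `a ≤ b ≤ c → b − a ≤ c − a` and `(c − a) − (b − a) = c − b`;
(ax2) `a ≤ b ≤ c → c − b ≤ c − a` and `(c − a) − (c − b) = b − a`. -/
structure Quasilogic (N : Type*) [PartialOrder N] where
  sub : N → N → N
  sub_le : ∀ a b : N, a ≤ b → sub b a ≤ b
  sub_sub_self : ∀ a b : N, a ≤ b → sub b (sub b a) = a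
  sub_le_sub_left : ∀ a b c : N, a ≤ b → b ≤ c → sub b a ≤ sub c a
  sub_sub_left : ∀ a b c : N, a ≤ b → b ≤ c → sub (sub c a) (sub b a) = sub c b
  sub_le_sub_right : ∀ a b c : N, a ≤ b → b ≤ c → sub c b ≤ sub c a
  sub_sub_right : ∀ a b c : N, a ≤ b → b ≤ c → sub (sub c a) (sub c b) = sub b a

namespace Quasilogic

variable {N : Type*} [PartialOrder N] (Q : Quasilogic N)

/-- The partial sum of `a` and `b` computed below `c` lies between `a` and `c`, and its difference
with `a` is `b`. -/
theorem sub_sub_sub_spec {a b c : N} (ha : a ≤ c) (hb : b ≤ Q.sub c a) :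
    a ≤ Q.sub c (Q.sub (Q.sub c a) b) ∧ Q.sub c (Q.sub (Q.sub c a) b) ≤ c ∧
      Q.sub (Q.sub c (Q.sub (Q.sub c a) b)) a = b := by
  have hca := Q.sub_le a c ha
  have hcab := Q.sub_le b _ hb
  have hle := Q.sub_le_sub_right _ _ _ hcab hca
  have heq := Q.sub_sub_right _ _ _ hcab hca
  rw [Q.sub_sub_self a c ha] at hle heq
  exact ⟨hle, Q.sub_le _ _ (hcab.trans hca), heq.trans (Q.sub_sub_self b _ hb)⟩

/-- If `s` dominates `a`, then it is the partial sum of `a` and `s − a` computed below any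
majorant of `s`. -/
theorem sub_sub_sub_eq {a s d : N} (ha : a ≤ s) (hs : s ≤ d) :
    Q.sub d (Q.sub (Q.sub d a) (Q.sub s a)) = s := by
  rw [Q.sub_sub_left a s d ha hs, Q.sub_sub_self s d hs]

end Quasilogic

/-- In an upwards directed quasilogic, the partial sum
`a + b := c − ((c − a) − b)` is independent of the choice of the majorant `c` and is
commutative. -/
theorem quasilogic_add_well_defined_and_comm {N : Type*} [PartialOrder N]
    (Q : Quasilogic N)
    (h_dir : ∀ a b : N, ∃ c : N, a ≤ c ∧ b ≤ c)
    (a b c₁ c₂ : N)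
    (h₁ : a ≤ c₁) (h₂ : a ≤ c₂)
    (hb₁ : b ≤ Q.sub c₁ a) (hb₂ : b ≤ Q.sub c₂ a) :
    Q.sub c₁ (Q.sub (Q.sub c₁ a) b) = Q.sub c₂ (Q.sub (Q.sub c₂ a) b) ∧
    Q.sub c₁ (Q.sub (Q.sub c₁ a) b) = Q.sub c₁ (Q.sub (Q.sub c₁ b) a) := by
  obtain ⟨ha₁, hs₁, e₁⟩ := Q.sub_sub_sub_spec h₁ hb₁
  obtain ⟨ha₂, hs₂, e₂⟩ := Q.sub_sub_sub_spec h₂ hb₂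
  obtain ⟨d, hd₁, hd₂⟩ := h_dir c₁ c₂
  constructor
  · have k₁ := Q.sub_sub_sub_eq ha₁ (hs₁.trans hd₁)
    have k₂ := Q.sub_sub_sub_eq ha₂ (hs₂.trans hd₂)
    rw [e₁] at k₁
    rw [e₂] at k₂
    exact k₁.symm.trans k₂
  · have hle := Q.sub_le _ _ ha₁
    have hsub := Q.sub_sub_self _ _ ha₁
    rw [e₁] at hle hsub
    have k := Q.sub_sub_sub_eq hle hs₁
    rw [hsub] at k
    exact k.symm
end

section
/- Let N be a quasilogic and let a, b, c ∈ N with a ≤ c and b ≤ c − a (so that a and b are summable with sum a + b = c − ((c − a) − b)). Suppose s is the least upper bound of {a, b} and t the greatest lower bound of {a, b}. Then s ≤ c, t ≤ c − s, and a + b = s + t, i.e. c − ((c − a) − b) = c − ((c − s) − t). -/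
/-- In an upwards directed quasilogic, if `a` and `b` are summable
(`a ≤ c` and `b ≤ c − a`) and if the supremum `s = a ⊔ b` and infimum `t = a ⊓ b` exist,
then `s ≤ c`, `t ≤ c − s`, and `a + b = s + t`, i.e.
`c − ((c − a) − b) = c − ((c − s) − t)`. -/
theorem quasilogic_add_eq_sup_add_inf {N : Type*} [PartialOrder N]
    (Q : Quasilogic N)
    (h_dir : ∀ a b : N, ∃ c : N, a ≤ c ∧ b ≤ c)
    (a b c s t : N) (ha : a ≤ c) (hb : b ≤ Q.sub c a)
    (hs : IsLUB {a, b} s) (ht : IsGLB {a, b} t) :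
    s ≤ c ∧ t ≤ Q.sub c s ∧
      Q.sub c (Q.sub (Q.sub c a) b) = Q.sub c (Q.sub (Q.sub c s) t) := by
  have hda := Q.sub_le b (Q.sub c a) hb
  have hac := Q.sub_le a c ha
  have hau := Q.sub_le_sub_right _ _ _ hda hac
  have hua := Q.sub_sub_right _ _ _ hda hac
  have huc := Q.sub_le _ _ (hda.trans hac)
  rw [Q.sub_sub_self a c ha] at hau hua
  rw [Q.sub_sub_self b _ hb] at hua
  -- `u` is the sum `a + b`, so that `u - a = b` and `u - b = a`
  generalize Q.sub c (Q.sub (Q.sub c a) b) = u at *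
  have hbu : b ≤ u := hua ▸ Q.sub_le a u hau
  have hub : Q.sub u b = a := hua ▸ Q.sub_sub_self a u hau
  have has : a ≤ s := hs.1 (by simp)
  have hbs : b ≤ s := hs.1 (by simp)
  have hta : t ≤ a := ht.1 (by simp)
  have htb : t ≤ b := ht.1 (by simp)
  have hsu : s ≤ u := hs.2 (by simp [hau, hbu])
  have hust : Q.sub u s ≤ t := ht.2 (by
    have h1 := Q.sub_le_sub_right a s u has hsu
    have h2 := Q.sub_le_sub_right b s u hbs hsu
    rw [hua] at h1
    rw [hub] at h2
    simp [h1, h2])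
  have hsut : s ≤ Q.sub u t := hs.2 (by
    have h1 := Q.sub_le_sub_right t a u hta hau
    have h2 := Q.sub_le_sub_right t b u htb hbu
    rw [hua] at h1
    rw [hub] at h2
    simp [h1, h2])
  have htus : t ≤ Q.sub u s := by
    have h := Q.sub_le_sub_right _ _ u hsut (Q.sub_le t u (hta.trans hau))
    rwa [Q.sub_sub_self t u (hta.trans hau)] at h
  obtain rfl : t = Q.sub u s := le_antisymm htus hust
  refine ⟨hsu.trans huc, Q.sub_le_sub_left s u c hsu huc, ?_⟩
  rw [Q.sub_sub_left s u c hsu huc, Q.sub_sub_self u c huc]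
end

section
/- Let N be a quasilogic. Then N has a unique least element 0, given by 0 = a − a for any a ∈ N; that is, a − a = b − b for all a, b ∈ N, and a − a ≤ c for every c ∈ N. -/
/-- In a quasilogic, `a - a = c - c` whenever `a ≤ c`. -/
theorem Quasilogic.sub_self_eq_of_le {N : Type*} [PartialOrder N] (Q : Quasilogic N)
    {a c : N} (h : a ≤ c) : Q.sub a a = Q.sub c c := by
  have ha := Q.sub_sub_self _ _ (Q.sub_le_sub_left a a c le_rfl h)
  have hc := Q.sub_sub_self _ _ (Q.sub_le_sub_right a c c h le_rfl)
  rw [Q.sub_sub_left a a c le_rfl h] at ha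
  rw [Q.sub_sub_right a c c h le_rfl] at hc
  exact ha.symm.trans hc

/-- An upwards directed quasilogic has a unique least element `0`,
given by `0 = a − a` for any `a`: indeed `a − a = b − b` for all `a, b`, and `a − a` is
below every element. -/
theorem quasilogic_least_element {N : Type*} [PartialOrder N]
    (Q : Quasilogic N)
    (h_dir : ∀ a b : N, ∃ c : N, a ≤ c ∧ b ≤ c) :
    (∀ a b : N, Q.sub a a = Q.sub b b) ∧
    (∀ a c : N, Q.sub a a ≤ c) := by
  have h : ∀ a b : N, Q.sub a a = Q.sub b b := fun a b => by
    obtain ⟨c, hac, hbc⟩ := h_dir a b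
    exact (Q.sub_self_eq_of_le hac).trans (Q.sub_self_eq_of_le hbc).symm
  exact ⟨h, fun a c => (h a c).trans_le (Q.sub_le c c le_rfl)⟩
end

section
/- Let A be a generalized Boolean algebra (a Boolean ring, possibly without unit). Then there exist a set X and an injective map h : A → 𝒫(X) such that h(⊥) = ∅, h(a ⊓ b) = h(a) ∩ h(b), h(a ⊔ b) = h(a) ∪ h(b), and h(a \ b) = h(a) \ h(b) for all a, b ∈ A. In particular every generalized Boolean algebra is isomorphic to a ring of subsets of some set. -/
/-- In a distributive lattice, if `a` is not below `b`, then some prime ideal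
contains `b` but not `a`. -/
theorem exists_isPrime_mem_notMem_of_not_le {α : Type*} [DistribLattice α]
    {a b : α} (hab : ¬ a ≤ b) :
    ∃ I : Order.Ideal α, I.IsPrime ∧ b ∈ I ∧ a ∉ I := by
  have hdisj : Disjoint (Order.PFilter.principal a : Set α) (Order.Ideal.principal b) :=
    Set.disjoint_left.2 fun _ hac hcb => hab (le_trans hac hcb)
  obtain ⟨I, hI, hbI, haI⟩ := DistribLattice.prime_ideal_of_disjoint_filter_ideal hdisj
  exact ⟨I, hI, hbI Order.Ideal.mem_principal_self,
    Set.disjoint_left.1 haI (Order.PFilter.mem_principal.2 le_rfl)⟩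

/-- A prime ideal of a generalized Boolean algebra omits `a \ b` exactly when it omits `a` and
contains `b`. -/
theorem Order.Ideal.IsPrime.sdiff_notMem_iff {α : Type*} [GeneralizedBooleanAlgebra α]
    {I : Order.Ideal α} (hI : I.IsPrime) {a b : α} : a \ b ∉ I ↔ a ∉ I ∧ b ∈ I := by
  refine ⟨fun h => ⟨fun ha => h (I.lower sdiff_le ha), ?_⟩, fun ⟨ha, hb⟩ h => ha ?_⟩
  · refine (hI.mem_or_mem (x := a \ b) (y := b) ?_).resolve_left h
    rw [inf_comm, inf_sdiff_self_right]
    exact I.bot_mem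
  · exact I.lower le_sdiff_sup (Order.Ideal.sup_mem h hb)

/-- **Stone representation for Boolean rings.**  Every generalized Boolean
algebra (Boolean ring, possibly without unit) is isomorphic to a ring of subsets of some
set: there are a set `X` and an injection `h : A → 𝒫(X)` preserving `⊥`, `⊓`, `⊔` and
set difference. -/
theorem generalized_boolean_algebra_representation {A : Type u}
    [GeneralizedBooleanAlgebra A] :
    ∃ (X : Type u) (h : A → Set X),
      Function.Injective h ∧
      h ⊥ = ∅ ∧
      (∀ a b : A, h (a ⊓ b) = h a ∩ h b) ∧
      (∀ a b : A, h (a ⊔ b) = h a ∪ h b) ∧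
      (∀ a b : A, h (a \ b) = h a \ h b) := by
  refine ⟨{I : Order.Ideal A // I.IsPrime}, fun a => {I | a ∉ I.1}, ?_, ?_, ?_, ?_, ?_⟩
  · have hle : ∀ a b : A, {I : {I : Order.Ideal A // I.IsPrime} | a ∉ I.1} ⊆ {I | b ∉ I.1} →
        a ≤ b := by
      intro a b hab
      by_contra hnle
      obtain ⟨I, hI, hb, ha⟩ := exists_isPrime_mem_notMem_of_not_le hnle
      exact hab (show (⟨I, hI⟩ : {I : Order.Ideal A // I.IsPrime}) ∈ {I | a ∉ I.1} from ha) hb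
    exact fun a b h => le_antisymm (hle a b h.subset) (hle b a h.superset)
  · exact Set.eq_empty_of_forall_notMem fun I hI => hI I.1.bot_mem
  · intro a b
    ext I
    exact ⟨fun h => ⟨fun ha => h (I.1.lower inf_le_left ha),
      fun hb => h (I.1.lower inf_le_right hb)⟩,
      fun h hab => (I.2.mem_or_mem hab).elim h.1 h.2⟩
  · intro a b
    ext I
    change a ⊔ b ∉ I.1 ↔ a ∉ I.1 ∨ b ∉ I.1
    rw [Order.Ideal.sup_mem_iff, not_and_or]
  · intro a b
    ext I
    change a \ b ∉ I.1 ↔ a ∉ I.1 ∧ ¬ b ∉ I.1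
    rw [I.2.sdiff_notMem_iff, not_not]
end

section
/- Let A be a generalized Boolean algebra (a Boolean ring, possibly without unit). Then there exist a topological space X which is locally compact, Hausdorff and totally disconnected, and an injective map h : A → 𝒫(X) with h(⊥) = ∅, h(a ⊓ b) = h(a) ∩ h(b), h(a ⊔ b) = h(a) ∪ h(b), h(a \ b) = h(a) \ h(b), such that every set h(a) is compact and open in X, the sets h(a) cover X and separate its points, and every compact open subset S ⊆ X is of the form S = h(a₁) ∪ … ∪ h(aₙ) for finitely many a₁, …, aₙ ∈ A. -/
/-- The points of the Stone space of a generalized Boolean algebra, given by the indicator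
functions of prime filters, as a subset of the Cantor cube `A → Bool`. -/
def stonePoints (A : Type*) [GeneralizedBooleanAlgebra A] : Set (A → Bool) :=
  {f | f ⊥ = false ∧ (∀ a b, f (a ⊓ b) = (f a && f b)) ∧ (∀ a b, f (a ⊔ b) = (f a || f b)) ∧
    ∃ a, f a = true}

/-- The set of points of the Stone space at which `a` holds. -/
def stoneSet {A : Type*} [GeneralizedBooleanAlgebra A] (a : A) : Set (stonePoints A) :=
  {x | x.1 a = true}

section StoneSpace

variable {A : Type*} [GeneralizedBooleanAlgebra A]

theorem mem_stoneSet {a : A} {x : stonePoints A} : x ∈ stoneSet a ↔ x.1 a = true := Iff.rfl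

theorem stonePoints_sdiff (x : stonePoints A) (a b : A) : x.1 (a \ b) = (x.1 a && !x.1 b) := by
  obtain ⟨f, hbot, hinf, hsup, -⟩ := x
  have h₁ := hsup (a ⊓ b) (a \ b)
  have h₂ := hinf (a ⊓ b) (a \ b)
  rw [sup_inf_sdiff, hinf] at h₁
  rw [inf_inf_sdiff, hbot, hinf] at h₂
  change f (a \ b) = (f a && !f b)
  revert h₁ h₂
  cases f a <;> cases f b <;> cases f (a \ b) <;> simp

theorem isOpen_stoneSet (a : A) : IsOpen (stoneSet a) :=
  (isOpen_discrete {true}).preimage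
    (show Continuous fun x : stonePoints A => x.1 a from
      (continuous_apply a).comp continuous_subtype_val)

theorem isCompact_stoneSet (a : A) : IsCompact (stoneSet a) := by
  rw [Subtype.isCompact_iff]
  have himage : Subtype.val '' stoneSet a =
      {f : A → Bool | f ⊥ = false ∧ (∀ a b, f (a ⊓ b) = (f a && f b)) ∧
        (∀ a b, f (a ⊔ b) = (f a || f b)) ∧ f a = true} := by
    ext f
    constructor
    · rintro ⟨x, hx, rfl⟩
      exact ⟨x.2.1, x.2.2.1, x.2.2.2.1, hx⟩
    · rintro ⟨hbot, hinf, hsup, hf⟩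
      exact ⟨⟨f, hbot, hinf, hsup, a, hf⟩, hf, rfl⟩
  rw [himage]
  apply IsClosed.isCompact
  have hcont (c : A) : Continuous fun f : A → Bool => f c := continuous_apply c
  have hop (op : Bool × Bool → Bool) (c d : A) :
      Continuous fun f : A → Bool => op (f c, f d) :=
    continuous_of_discreteTopology.comp ((hcont c).prodMk (hcont d))
  have hlaw (m : A → A → A) (op : Bool × Bool → Bool) :
      IsClosed {f : A → Bool | ∀ c d, f (m c d) = op (f c, f d)} := by
    simp only [Set.ofPred_forall]
    exact isClosed_iInter fun c => isClosed_iInter fun d => isClosed_eq (hcont _) (hop op c d)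
  exact (isClosed_eq (hcont ⊥) continuous_const).inter
    ((hlaw (· ⊓ ·) fun p => p.1 && p.2).inter
      ((hlaw (· ⊔ ·) fun p => p.1 || p.2).inter (isClosed_eq (hcont a) continuous_const)))

theorem exists_mem_stoneSet (x : stonePoints A) : ∃ a, x ∈ stoneSet a :=
  x.2.2.2.2

theorem exists_stoneSet_agree (x : stonePoints A) (I : Finset A) :
    ∃ a, x ∈ stoneSet a ∧ ∀ y ∈ stoneSet a, ∀ i ∈ I, y.1 i = x.1 i := by
  classical
  induction I using Finset.induction_on with
  | empty =>
    obtain ⟨a, ha⟩ := exists_mem_stoneSet x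
    exact ⟨a, ha, by simp⟩
  | insert i I _ ih =>
    obtain ⟨a, ha, hI⟩ := ih
    rw [mem_stoneSet] at ha
    by_cases hi : x.1 i = true
    · refine ⟨a ⊓ i, by simp [mem_stoneSet, x.2.2.1, ha, hi], fun y hy => ?_⟩
      rw [mem_stoneSet, y.2.2.1, Bool.and_eq_true] at hy
      simpa [hy.2, hi] using hI y hy.1
    · rw [Bool.not_eq_true] at hi
      refine ⟨a \ i, by simp [mem_stoneSet, stonePoints_sdiff, ha, hi], fun y hy => ?_⟩
      rw [mem_stoneSet, stonePoints_sdiff, Bool.and_eq_true, Bool.not_eq_true'] at hy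
      simpa [hy.2, hi] using hI y hy.1

theorem exists_stoneSet_subset {S : Set (stonePoints A)} (hS : IsOpen S) {x : stonePoints A}
    (hx : x ∈ S) : ∃ a, x ∈ stoneSet a ∧ stoneSet a ⊆ S := by
  obtain ⟨U, hU, rfl⟩ := isOpen_induced_iff.mp hS
  obtain ⟨I, u, hu, hIU⟩ := isOpen_pi_iff.mp hU x.1 hx
  obtain ⟨a, ha, hI⟩ := exists_stoneSet_agree x I
  refine ⟨a, ha, fun y hy => hIU fun i hi => ?_⟩
  rw [hI y hy i hi]
  exact (hu i hi).2

theorem le_of_stoneSet_subset {a b : A} (h : stoneSet a ⊆ stoneSet b) : a ≤ b := by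
  classical
  by_contra hab
  have hdisj : Disjoint (Order.PFilter.principal a : Set A) (Order.Ideal.principal b : Set A) :=
    Set.disjoint_left.mpr fun c hac hcb => hab
      ((Order.PFilter.mem_principal.mp hac).trans (Order.Ideal.mem_principal.mp hcb))
  obtain ⟨J, hJ, hbJ, haJ⟩ := DistribLattice.prime_ideal_of_disjoint_filter_ideal hdisj
  have ha : a ∉ J := Set.disjoint_left.mp haJ (Order.PFilter.mem_principal.mpr le_rfl)
  have hb : b ∈ J := hbJ (Order.Ideal.mem_principal.mpr le_rfl)
  have hinf (c d : A) : c ⊓ d ∈ J ↔ c ∈ J ∨ d ∈ J :=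
    ⟨hJ.mem_or_mem, fun hcd => hcd.elim (J.lower inf_le_left) (J.lower inf_le_right)⟩
  let x : stonePoints A := ⟨fun c => decide (c ∉ J), by simp,
    fun c d => by simp [hinf], fun c d => by simp [Order.Ideal.sup_mem_iff, imp_iff_not_or],
    a, by simpa using ha⟩
  have hxb : x ∈ stoneSet b := h (show decide (a ∉ J) = true by simpa using ha)
  exact (of_decide_eq_true (p := b ∉ J) hxb) hb

theorem stoneSet_injective : Function.Injective (stoneSet : A → Set (stonePoints A)) :=
  fun _ _ h => le_antisymm (le_of_stoneSet_subset h.subset) (le_of_stoneSet_subset h.superset)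

instance : WeaklyLocallyCompactSpace (stonePoints A) where
  exists_compact_mem_nhds x :=
    let ⟨a, ha⟩ := exists_mem_stoneSet x
    ⟨stoneSet a, isCompact_stoneSet a, (isOpen_stoneSet a).mem_nhds ha⟩

theorem IsCompact.exists_eq_iUnion_stoneSet {S : Set (stonePoints A)} (hS : IsCompact S)
    (hSo : IsOpen S) : ∃ (n : ℕ) (f : Fin n → A), S = ⋃ i, stoneSet (f i) := by
  obtain ⟨t, ht⟩ := hS.elim_finite_subcover (fun a : {a : A // stoneSet a ⊆ S} => stoneSet a.1)
    (fun a => isOpen_stoneSet a.1) fun x hx => by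
      obtain ⟨a, ha, haS⟩ := exists_stoneSet_subset hSo hx
      exact Set.mem_iUnion.mpr ⟨⟨a, haS⟩, ha⟩
  refine ⟨t.card, fun i => (t.equivFin.symm i).1.1, subset_antisymm (fun x hx => ?_)
    (Set.iUnion_subset fun i => (t.equivFin.symm i).1.2)⟩
  obtain ⟨a, hat, hxa⟩ := Set.mem_iUnion₂.mp (ht hx)
  exact Set.mem_iUnion.mpr ⟨t.equivFin ⟨a, hat⟩, by simpa using hxa⟩

end StoneSpace

/-- **Stone representation, topological form.**  Every generalized Boolean
algebra is represented by the compact open subsets of a locally compact, Hausdorff,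
totally disconnected space `X` (its Stone space of maximal filters): there is an
injection `h : A → 𝒫(X)` preserving `⊥`, `⊓`, `⊔` and set difference, each `h a` is
compact open, the sets `h a` cover `X` and separate its points, and every compact open
subset of `X` is a finite union of sets `h a`. -/
theorem generalized_boolean_algebra_stone_representation {A : Type u}
    [GeneralizedBooleanAlgebra A] :
    ∃ (X : Type u) (t : TopologicalSpace X) (h : A → Set X),
      @LocallyCompactSpace X t ∧
      @T2Space X t ∧
      @TotallyDisconnectedSpace X t ∧
      Function.Injective h ∧
      h ⊥ = ∅ ∧
      (∀ a b : A, h (a ⊓ b) = h a ∩ h b) ∧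
      (∀ a b : A, h (a ⊔ b) = h a ∪ h b) ∧
      (∀ a b : A, h (a \ b) = h a \ h b) ∧
      (∀ a : A, @IsCompact X t (h a) ∧ @IsOpen X t (h a)) ∧
      (⋃ a : A, h a) = Set.univ ∧
      (∀ x y : X, x ≠ y → ∃ a : A, (x ∈ h a ∧ y ∉ h a) ∨ (y ∈ h a ∧ x ∉ h a)) ∧
      (∀ S : Set X, @IsCompact X t S → @IsOpen X t S →
        ∃ (n : ℕ) (f : Fin n → A), S = ⋃ i : Fin n, h (f i)) := by
  refine ⟨stonePoints A, inferInstance, stoneSet, inferInstance, inferInstance, inferInstance,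
    stoneSet_injective, ?_, fun a b => ?_, fun a b => ?_, fun a b => ?_,
    fun a => ⟨isCompact_stoneSet a, isOpen_stoneSet a⟩, ?_, fun x y hxy => ?_,
    fun S hS hSo => hS.exists_eq_iUnion_stoneSet hSo⟩
  · ext x
    simp [mem_stoneSet, x.2.1]
  · ext x
    simp [mem_stoneSet, x.2.2.1]
  · ext x
    simp [mem_stoneSet, x.2.2.2.1]
  · ext x
    simp [mem_stoneSet, stonePoints_sdiff]
  · exact Set.iUnion_eq_univ_iff.mpr exists_mem_stoneSet
  · obtain ⟨a, ha⟩ := Function.ne_iff.mp (Subtype.coe_ne_coe.mpr hxy)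
    refine ⟨a, ?_⟩
    rw [mem_stoneSet, mem_stoneSet]
    revert ha
    cases x.1 a <;> cases y.1 a <;> simp
end

section
/- Let X be a Hausdorff topological space and let R be a ring of subsets of X (∅ ∈ R, and R is closed under finite unions and set differences). Let μ : R → [0, ∞) be finitely additive (μ(A ∪ B) = μ(A) + μ(B) for disjoint A, B ∈ R) and inner regular with respect to compact members of R: μ(A) = sup{μ(K) : K ⊆ A, K ∈ R, K compact} for every A ∈ R. Then μ is countably additive: for every sequence (Aₙ) of pairwise disjoint members of R whose union A = ⋃ₙ Aₙ belongs to R, μ(A) = ∑ₙ μ(Aₙ). -/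
open MeasureTheory Filter Topology Set
open scoped NNReal Function

namespace MeasureTheory.AddContent

/-- A content on a ring of sets that is inner regular with respect to a compact system is
continuous at `∅`. -/
theorem tendsto_zero_of_isCompactSystem {X : Type*} {C S : Set (Set X)} (hC : IsSetRing C)
    (hS : IsCompactSystem S) (m : AddContent ℝ≥0 C)
    (hm : ∀ A ∈ C, ∀ ε : ℝ≥0, 0 < ε → ∃ K ∈ C, K ∈ S ∧ K ⊆ A ∧ m (A \ K) < ε)
    {s : ℕ → Set X} (hs : ∀ n, s n ∈ C) (hs_anti : Antitone s) (hs_empty : ⋂ n, s n = ∅) :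
    Tendsto (fun n => m (s n)) atTop (𝓝 0) := by
  rw [NNReal.nhds_zero_basis.tendsto_right_iff]
  intro ε hε
  obtain ⟨δ, hδ, c, hδc, hcε⟩ := NNReal.exists_pos_sum_of_countable hε.ne' ℕ
  choose K hKC hKS hKs hKδ using fun n => hm (s n) (hs n) (δ n) (hδ n)
  obtain ⟨N, hN⟩ := hS K hKS (subset_eq_empty (iInter_mono hKs) hs_empty)
  have hdiff : ∀ n, s n \ K n ∈ C := fun n => hC.sdiff_mem (hs n) (hKC n)
  have hcover : s N ⊆ ⋃ i ∈ Finset.range (N + 1), s i \ K i := by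
    intro x hx
    have hxK : x ∉ dissipate K N := by simp [hN]
    simp only [mem_dissipate, not_forall] at hxK
    obtain ⟨i, hi, hxi⟩ := hxK
    exact mem_biUnion (Finset.mem_range.2 (Nat.lt_succ_of_le hi)) ⟨hs_anti hi hx, hxi⟩
  filter_upwards [eventually_ge_atTop N] with n hn
  calc m (s n) ≤ m (⋃ i ∈ Finset.range (N + 1), s i \ K i) :=
        addContent_mono hC.isSetSemiring (hs n) (hC.biUnion_mem _ fun i _ => hdiff i)
          ((hs_anti hn).trans hcover)
    _ ≤ ∑ i ∈ Finset.range (N + 1), m (s i \ K i) := addContent_biUnion_le hC fun i _ => hdiff i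
    _ ≤ ∑ i ∈ Finset.range (N + 1), δ i := Finset.sum_le_sum fun i _ => (hKδ i).le
    _ ≤ c := sum_le_hasSum _ (fun _ _ => zero_le) hδc
    _ < ε := hcε

/-- A content on a ring of sets that is inner regular with respect to a compact system is
countably additive. -/
theorem hasSum_iUnion_of_isCompactSystem {X : Type*} {C S : Set (Set X)} (hC : IsSetRing C)
    (hS : IsCompactSystem S) (m : AddContent ℝ≥0 C)
    (hm : ∀ A ∈ C, ∀ ε : ℝ≥0, 0 < ε → ∃ K ∈ C, K ∈ S ∧ K ⊆ A ∧ m (A \ K) < ε)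
    {f : ℕ → Set X} (hf : ∀ n, f n ∈ C) (hf_disj : Pairwise (Disjoint on f))
    (hUf : ⋃ n, f n ∈ C) :
    HasSum (fun n => m (f n)) (m (⋃ n, f n)) := by
  have hacc := hC.accumulate_mem hf
  have hrest : Tendsto (fun n => m ((⋃ i, f i) \ accumulate f n)) atTop (𝓝 0) := by
    refine tendsto_zero_of_isCompactSystem hC hS m hm (fun n => hC.sdiff_mem hUf (hacc n))
      (fun i j hij => sdiff_subset_sdiff_right (monotone_accumulate hij)) ?_
    rw [← sdiff_iUnion, iUnion_accumulate, sdiff_self]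
  have hsplit : ∀ n, m (⋃ i, f i) =
      ∑ i ∈ Finset.range (n + 1), m (f i) + m ((⋃ i, f i) \ accumulate f n) := by
    intro n
    rw [← addContent_accumulate m hC hf_disj hf,
      ← addContent_union hC (hacc n) (hC.sdiff_mem hUf (hacc n)) disjoint_sdiff_right,
      union_sdiff_cancel (accumulate_subset_iUnion n)]
  rw [NNReal.hasSum_iff_tendsto_nat, ← tendsto_add_atTop_iff_nat 1]
  have hsub := (tendsto_const_nhds (x := m (⋃ i, f i))).sub hrest
  rw [tsub_zero] at hsub
  refine hsub.congr fun n => ?_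
  rw [hsplit n, add_tsub_cancel_right]

end MeasureTheory.AddContent

/-- A finitely additive, nonnegative set function on a ring of subsets
of a Hausdorff space which is inner regular with respect to its compact members is
countably additive: if pairwise disjoint sets `Aₙ` of the ring have union `A` in the
ring, then the series `∑ₙ μ(Aₙ)` converges to `μ(A)`. -/
theorem inner_regular_implies_countably_additive {X : Type*}
    [TopologicalSpace X] [T2Space X]
    (R : Set (Set X))
    (h_empty : ∅ ∈ R)
    (h_union : ∀ A B : Set X, A ∈ R → B ∈ R → A ∪ B ∈ R)
    (h_diff : ∀ A B : Set X, A ∈ R → B ∈ R → A \ B ∈ R)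
    (μ : Set X → ℝ)
    (h_nonneg : ∀ A ∈ R, 0 ≤ μ A)
    (h_add : ∀ A B : Set X, A ∈ R → B ∈ R → Disjoint A B → μ (A ∪ B) = μ A + μ B)
    (h_reg : ∀ A ∈ R,
      IsLUB {r : ℝ | ∃ K : Set X, K ∈ R ∧ K ⊆ A ∧ IsCompact K ∧ r = μ K} (μ A)) :
    ∀ f : ℕ → Set X, (∀ n, f n ∈ R) → (∀ m n : ℕ, m ≠ n → Disjoint (f m) (f n)) →
      (⋃ n, f n) ∈ R → HasSum (fun n => μ (f n)) (μ (⋃ n, f n)) := by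
  intro f hf hf_disj hUf
  have hR : IsSetRing R :=
    ⟨h_empty, fun A B hA hB => h_union A B hA hB, fun A B hA hB => h_diff A B hA hB⟩
  have hμ_empty : μ ∅ = 0 := by
    simpa using h_add ∅ ∅ h_empty h_empty (disjoint_empty ∅)
  let m : AddContent ℝ≥0 R := hR.addContent_of_union (fun A => (μ A).toNNReal)
    (by simp [hμ_empty]) fun {A B} hA hB hAB => by
      rw [h_add A B hA hB hAB, Real.toNNReal_add (h_nonneg A hA) (h_nonneg B hB)]
  have hm : ∀ A ∈ R, (m A : ℝ) = μ A := fun A hA => Real.coe_toNNReal _ (h_nonneg A hA)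
  have hm_reg : ∀ A ∈ R, ∀ ε : ℝ≥0, 0 < ε →
      ∃ K ∈ R, K ∈ {K | IsCompact K} ∧ K ⊆ A ∧ m (A \ K) < ε := by
    intro A hA ε hε
    obtain ⟨_, ⟨K, hKR, hKA, hK, rfl⟩, hlt, -⟩ :=
      (h_reg A hA).exists_between (sub_lt_self (μ A) (NNReal.coe_pos.2 hε))
    refine ⟨K, hKR, hK, hKA, ?_⟩
    have hadd := h_add K (A \ K) hKR (h_diff A K hA hKR) disjoint_sdiff_right
    rw [union_sdiff_cancel hKA] at hadd
    rw [← NNReal.coe_lt_coe, hm _ (h_diff A K hA hKR)]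
    linarith
  have hsum := m.hasSum_iUnion_of_isCompactSystem hR (isCompactSystem_isCompact X) hm_reg hf
    (fun i j hij => hf_disj i j hij) hUf
  simpa only [hm _ (hf _), hm _ hUf] using NNReal.hasSum_coe.2 hsum
end
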